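/- Let K, L ∈ ℕ with L > K, let α ∈ 𝒞_{K,L} with associated sequence (n_k), and let f(x) = -log x - log(1-x) + g(x) with g ∈ C³(𝕋), g > 0. There exist constants D > 0, b₀ > 0 and k₀ ∈ ℕ such that for every k ≥ k₀ and every b ≥ b₀: D⁻¹·e^{−b} ≤ Leb(A_k(b)) ≤ D·e^{−b}, where A_k(b) = {x ∈ 𝕋 : |S_{q_{n_k}}(f)(x) − c_k| ≥ b} with x_k = 1/(2q_{n_k}) and c_k = S_{q_{n_k}}(f)(x_k). -/

import Mathlib

open MeasureTheory Filter Topology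

noncomputable section

/-- Iterates of the Gauss map applied to the fractional part of `α`. -/
def gaussIter (α : ℝ) (n : ℕ) : ℝ := (fun x : ℝ => Int.fract x⁻¹)^[n] (Int.fract α)

/-- The `n`-th partial quotient `a_n` of the continued fraction expansion of `α`
(for `n ≥ 1`). -/
def cfA (α : ℝ) (n : ℕ) : ℕ := ⌊(gaussIter α (n - 1))⁻¹⌋₊

/-- The denominators `q_n` of the convergents of the continued fraction of `α`:
`q₀ = 1`, `q₁ = a₁`, `q_{n+1} = a_{n+1} q_n + q_{n-1}`. -/
def cfQ (α : ℝ) : ℕ → ℕ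
  | 0 => 1
  | 1 => cfA α 1
  | n + 2 => cfA α (n + 2) * cfQ α (n + 1) + cfQ α n

/-- Birkhoff sums over the rotation by `α`: `S_n(φ)(x) = ∑_{i<n} φ(x + iα)`. -/
def birkhoffRot (α : ℝ) (φ : ℝ → ℝ) (n : ℕ) (x : ℝ) : ℝ :=
  ∑ i ∈ Finset.range n, φ (x + i * α)

/-- Distance to the nearest integer, `‖x‖ = min(x mod 1, 1 - x mod 1)`. -/
def distNearestInt (x : ℝ) : ℝ := min (Int.fract x) (1 - Int.fract x)

/-- `h(x) = -log x - log(1-x)`, read on the circle. -/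
def symLog (x : ℝ) : ℝ := -Real.log (Int.fract x) - Real.log (1 - Int.fract x)

/-- The roof `f(x) = -log x - log(1-x) + g(x)`, read on the circle. -/
def symLogRoof (g : ℝ → ℝ) (x : ℝ) : ℝ := symLog x + g x

/-- The set `A_k(b) = {x ∈ 𝕋 : |S_q(f)(x) - c_k| ≥ b}` where `q = q_{n_k}` and
`c_k = S_q(f)(x_k)` with `x_k = 1/(2q)` (here `𝕋` is represented by `[0,1)`). -/
def AkSet (α : ℝ) (g : ℝ → ℝ) (q : ℕ) (b : ℝ) : Set ℝ :=
  {x | x ∈ Set.Ico (0 : ℝ) 1 ∧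
    b ≤ |birkhoffRot α (symLogRoof g) q x
          - birkhoffRot α (symLogRoof g) q (1 / (2 * (q : ℝ)))|}

/-- The odd kernel `x⁻¹ - (1 - x)⁻¹` on the circle, with value `0` at the integers. -/
def oddKer (x : ℝ) : ℝ := (Int.fract x)⁻¹ - (Int.fract (-x))⁻¹

/-- The even kernel `x⁻² + (1 - x)⁻²` on the circle, with value `0` at the integers. -/
def sqKer (x : ℝ) : ℝ := ((Int.fract x)⁻¹) ^ 2 + ((Int.fract (-x))⁻¹) ^ 2

lemma oddKer_neg (x : ℝ) : oddKer (-x) = -oddKer x := by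
  simp [oddKer]

lemma oddKer_periodic : Function.Periodic oddKer 1 := by
  intro x
  have h : -(x + 1) = -x - 1 := by ring
  simp [oddKer, h]

lemma sqKer_periodic : Function.Periodic sqKer 1 := by
  intro x
  have h : -(x + 1) = -x - 1 := by ring
  simp [sqKer, h]

lemma symLog_periodic : Function.Periodic symLog 1 := by
  intro x
  simp [symLog]

lemma oddKer_zero : oddKer 0 = 0 := by simp [oddKer]

lemma symLog_zero : symLog 0 = 0 := by simp [symLog]

lemma sqKer_nonneg (x : ℝ) : 0 ≤ sqKer x := by unfold sqKer; positivity

lemma periodic_add_int {φ : ℝ → ℝ} (hφ : Function.Periodic φ 1) (x : ℝ) (z : ℤ) :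
    φ (x + z) = φ x := by
  simpa using hφ.int_mul z x

lemma periodic_int {φ : ℝ → ℝ} (hφ : Function.Periodic φ 1) (z : ℤ) : φ z = φ 0 := by
  simpa using periodic_add_int hφ 0 z

lemma fract_add_small {y s d : ℝ} (h1 : d ≤ Int.fract y) (h2 : d ≤ Int.fract (-y))
    (hd : 0 < d) (hs : |s| ≤ 52 / 100 * d) :
    Int.fract (-y) = 1 - Int.fract y ∧ Int.fract (y + s) = Int.fract y + s ∧
      Int.fract (-(y + s)) = 1 - Int.fract y - s := by
  have hy : Int.fract y ≠ 0 := by linarith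
  have e1 : Int.fract (-y) = 1 - Int.fract y := Int.fract_neg hy
  obtain ⟨hs1, hs2⟩ := abs_le.1 hs
  have e2 : Int.fract (y + s) = Int.fract y + s := by
    rw [Int.fract_eq_iff]
    refine ⟨by linarith, by linarith, ⌊y⌋, ?_⟩
    have := Int.floor_add_fract y
    linarith
  refine ⟨e1, e2, ?_⟩
  rw [Int.fract_neg (by rw [e2]; linarith), e2]; ring

lemma abs_inv_add_sub_inv_le {y s : ℝ} (hy : 0 < y) (hs : |s| ≤ 52 / 100 * y) :
    |(y + s)⁻¹ - y⁻¹| ≤ 3 * |s| * (y⁻¹) ^ 2 := by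
  obtain ⟨hs1, hs2⟩ := abs_le.1 hs
  have hp : 0 < y + s := by linarith
  have e : (y + s)⁻¹ - y⁻¹ = -s * (y⁻¹ * (y + s)⁻¹) := by field_simp; ring
  rw [e, abs_mul, abs_neg, abs_of_pos (by positivity : 0 < y⁻¹ * (y + s)⁻¹)]
  have : (y + s)⁻¹ ≤ 3 * y⁻¹ := by
    rw [inv_le_comm₀ hp (by positivity), mul_inv, inv_inv]; linarith
  calc |s| * (y⁻¹ * (y + s)⁻¹) ≤ |s| * (y⁻¹ * (3 * y⁻¹)) := by gcongr
    _ = _ := by ring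

lemma oddKer_add_sub_le {y s d : ℝ} (h1 : d ≤ Int.fract y) (h2 : d ≤ Int.fract (-y))
    (hd : 0 < d) (hs : |s| ≤ 52 / 100 * d) :
    |oddKer (y + s) - oddKer y| ≤ 3 * |s| * sqKer y := by
  obtain ⟨e1, e2, e3⟩ := fract_add_small h1 h2 hd hs
  have b1 := abs_inv_add_sub_inv_le (y := Int.fract y) (s := s) (by linarith) (by linarith)
  have b2 := abs_inv_add_sub_inv_le (y := 1 - Int.fract y) (s := -s) (by linarith)
    (by rw [abs_neg]; linarith)
  rw [abs_neg, ← sub_eq_add_neg] at b2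
  unfold oddKer sqKer
  rw [e2, e3, e1]
  calc _ = |((Int.fract y + s)⁻¹ - (Int.fract y)⁻¹)
        - ((1 - Int.fract y - s)⁻¹ - (1 - Int.fract y)⁻¹)| := by congr 1; ring
    _ ≤ _ := abs_sub _ _
    _ ≤ _ := by linarith

lemma abs_log_add_sub_le {y s : ℝ} (hy : 0 < y) (hs : |s| ≤ 52 / 100 * y) :
    |Real.log (y + s) - Real.log y - s * y⁻¹| ≤ 3 * s ^ 2 * (y⁻¹) ^ 2 := by
  obtain ⟨hs1, hs2⟩ := abs_le.1 hs
  have hp : 0 < y + s := by linarith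
  rw [← Real.log_div hp.ne' hy.ne']
  have hq : 0 < (y + s) / y := by positivity
  have u := Real.log_le_sub_one_of_pos hq
  have l := Real.one_sub_inv_le_log_of_pos hq
  have e1 : (y + s) / y - 1 = s * y⁻¹ := by field_simp; ring
  have e2 : 1 - ((y + s) / y)⁻¹ = s * y⁻¹ - s ^ 2 * (y⁻¹ * (y + s)⁻¹) := by field_simp; ring
  have : (y + s)⁻¹ ≤ 3 * y⁻¹ := by
    rw [inv_le_comm₀ hp (by positivity), mul_inv, inv_inv]; linarith
  have h3 : s ^ 2 * (y⁻¹ * (y + s)⁻¹) ≤ 3 * s ^ 2 * (y⁻¹) ^ 2 := by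
    calc s ^ 2 * (y⁻¹ * (y + s)⁻¹) ≤ s ^ 2 * (y⁻¹ * (3 * y⁻¹)) := by gcongr
      _ = _ := by ring
  have h4 : 0 ≤ 3 * s ^ 2 * (y⁻¹) ^ 2 := by positivity
  rw [abs_le]; constructor <;> linarith

lemma symLog_add_sub_le {y s d : ℝ} (h1 : d ≤ Int.fract y) (h2 : d ≤ Int.fract (-y))
    (hd : 0 < d) (hs : |s| ≤ 52 / 100 * d) :
    |symLog (y + s) - symLog y + s * oddKer y| ≤ 3 * s ^ 2 * sqKer y := by
  obtain ⟨e1, e2, e3⟩ := fract_add_small h1 h2 hd hs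
  have b1 := abs_log_add_sub_le (y := Int.fract y) (s := s) (by linarith) (by linarith)
  have b2 := abs_log_add_sub_le (y := 1 - Int.fract y) (s := -s) (by linarith)
    (by rw [abs_neg]; linarith)
  rw [neg_sq, ← sub_eq_add_neg] at b2
  unfold oddKer sqKer symLog
  rw [e2, e1, ← sub_sub]
  calc _ = |-((Real.log (Int.fract y + s) - Real.log (Int.fract y) - s * (Int.fract y)⁻¹)
        + (Real.log (1 - Int.fract y - s) - Real.log (1 - Int.fract y)
          - -s * (1 - Int.fract y)⁻¹))| := by congr 1; ring
    _ ≤ _ := (abs_neg _).trans_le (abs_add_le _ _)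
    _ ≤ _ := by linarith

lemma inv_le_fract_of_not_dvd {q : ℕ} (hq : 0 < q) {k : ℤ} (hk : ¬ (q : ℤ) ∣ k) :
    (q : ℝ)⁻¹ ≤ Int.fract ((k : ℝ) / q) := by
  rw [Int.fract_div_intCast_eq_div_intCast_mod]
  have h1 : k % (q : ℤ) ≠ 0 := fun h => hk (Int.dvd_of_emod_eq_zero h)
  have h2 : 0 ≤ k % (q : ℤ) := Int.emod_nonneg _ (by omega)
  have h3 : (1 : ℝ) ≤ ((k % (q : ℤ) : ℤ) : ℝ) := by exact_mod_cast (by omega : 1 ≤ k % (q : ℤ))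
  rw [inv_eq_one_div]
  gcongr

lemma inv_le_fract_neg_of_not_dvd {q : ℕ} (hq : 0 < q) {k : ℤ} (hk : ¬ (q : ℤ) ∣ k) :
    (q : ℝ)⁻¹ ≤ Int.fract (-((k : ℝ) / q)) := by
  have := inv_le_fract_of_not_dvd hq (k := -k) (by rwa [dvd_neg])
  rwa [Int.cast_neg, neg_div] at this

lemma periodic_div_of_modEq {φ : ℝ → ℝ} (hφ : Function.Periodic φ 1) {q : ℕ} (hq : 0 < q)
    {k l : ℤ} (h : k ≡ l [ZMOD q]) : φ ((k : ℝ) / q) = φ ((l : ℝ) / q) := by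
  obtain ⟨z, hz⟩ := h.symm.dvd
  have hq' : (q : ℝ) ≠ 0 := by positivity
  have : (k : ℝ) / q = (l : ℝ) / q + z := by
    have : (k : ℝ) - l = q * z := by exact_mod_cast hz
    field_simp; linarith
  rw [this, periodic_add_int hφ]

lemma sum_periodic_reindex {φ : ℝ → ℝ} (hφ : Function.Periodic φ 1) {q : ℕ} (hq : 0 < q)
    {p : ℤ} (hp : IsCoprime p (q : ℤ)) (m : ℤ) :
    ∑ i ∈ Finset.range q, φ (((((i : ℤ) - m) * p : ℤ) : ℝ) / q)
      = ∑ j ∈ Finset.range q, φ ((j : ℝ) / q) := by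
  have hq' : (0 : ℤ) < q := by exact_mod_cast hq
  let e : ℕ → ℕ := fun i => ((((i : ℤ) - m) * p) % (q : ℤ)).toNat
  have he : ∀ i, ((e i : ℕ) : ℤ) = (((i : ℤ) - m) * p) % (q : ℤ) := fun i =>
    Int.toNat_of_nonneg (Int.emod_nonneg _ hq'.ne')
  have hmap : ∀ i ∈ Finset.range q, e i ∈ Finset.range q := by
    intro i _
    have := Int.emod_lt_of_pos (((i : ℤ) - m) * p) hq'
    rw [← he] at this
    simpa using this
  have hinj : Set.InjOn e (Finset.range q) := by
    intro i hi j hj hij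
    have h1 : (((i : ℤ) - m) * p) % (q : ℤ) = (((j : ℤ) - m) * p) % (q : ℤ) := by
      rw [← he, ← he, hij]
    have h2 : (q : ℤ) ∣ ((j : ℤ) - i) * p := by
      have := (Int.ModEq.dvd (n := (q : ℤ)) h1)
      convert this using 1; ring
    have h3 : (q : ℤ) ∣ (j : ℤ) - i := hp.symm.dvd_of_dvd_mul_right h2
    simp only [Finset.coe_range, Set.mem_Iio] at hi hj
    have := Int.eq_zero_of_abs_lt_dvd h3 (by rw [abs_lt]; omega)
    omega
  refine Finset.sum_nbij e hmap hinj
    (Finset.surjOn_of_injOn_of_card_le e hmap hinj le_rfl) ?_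
  intro i _
  have h := periodic_div_of_modEq hφ hq (k := ((i : ℤ) - m) * p) (l := (e i : ℕ))
    (by rw [he]; exact (Int.mod_modEq _ _).symm)
  rw [h]; simp

lemma sum_oddKer_div (q : ℕ) (hq : 0 < q) :
    ∑ j ∈ Finset.range q, oddKer ((j : ℝ) / q) = 0 := by
  have h := sum_periodic_reindex oddKer_periodic hq (p := -1) (isCoprime_one_left.neg_left) 0
  have h2 : ∀ i : ℕ, oddKer (((((i : ℤ) - 0) * (-1) : ℤ) : ℝ) / q) = -oddKer ((i : ℝ) / q) := by
    intro i
    rw [← oddKer_neg]; congr 1; push_cast; ring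
  simp only [h2, Finset.sum_neg_distrib] at h
  linarith

lemma sum_inv_sq_range_le (n : ℕ) :
    ∑ j ∈ Finset.range (n + 1), ((j : ℝ)⁻¹) ^ 2 ≤ 2 - (n : ℝ)⁻¹ := by
  induction n with
  | zero => simp
  | succ n ih =>
    rw [Finset.sum_range_succ]
    rcases Nat.eq_zero_or_pos n with rfl | hn
    · norm_num
    have hn' : (0 : ℝ) < n := by exact_mod_cast hn
    have e : (n : ℝ)⁻¹ - ((n : ℝ) + 1)⁻¹ = (n : ℝ)⁻¹ * ((n : ℝ) + 1)⁻¹ := by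
      field_simp; ring
    have : (((n : ℝ) + 1)⁻¹) ^ 2 ≤ (n : ℝ)⁻¹ * ((n : ℝ) + 1)⁻¹ := by
      rw [sq]; gcongr; linarith
    push_cast
    linarith

lemma sum_sqKer_div_le (q : ℕ) (hq : 0 < q) :
    ∑ j ∈ Finset.range q, sqKer ((j : ℝ) / q) ≤ 4 * (q : ℝ) ^ 2 := by
  let v : ℝ → ℝ := fun x => ((Int.fract x)⁻¹) ^ 2
  have hv : Function.Periodic v 1 := by intro x; simp [v]
  have h := sum_periodic_reindex hv hq (p := -1) (isCoprime_one_left.neg_left) 0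
  have h2 : ∀ i : ℕ, v (((((i : ℤ) - 0) * (-1) : ℤ) : ℝ) / q) = v (-((i : ℝ) / q)) := by
    intro i
    congr 1; push_cast; ring
  simp only [h2] at h
  have hb : ∑ j ∈ Finset.range q, v ((j : ℝ) / q) ≤ 2 * (q : ℝ) ^ 2 := by
    have e : ∀ j ∈ Finset.range q, v ((j : ℝ) / q) = (q : ℝ) ^ 2 * ((j : ℝ)⁻¹) ^ 2 := by
      intro j hj
      have hj' : (j : ℝ) < q := by exact_mod_cast Finset.mem_range.1 hj
      have hq' : (0 : ℝ) < q := by positivity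
      have : Int.fract ((j : ℝ) / q) = (j : ℝ) / q :=
        Int.fract_eq_self.2 ⟨by positivity, (div_lt_one hq').2 hj'⟩
      simp only [v, this]
      rw [inv_div, div_eq_mul_inv, mul_pow]
    rw [Finset.sum_congr rfl e, ← Finset.mul_sum]
    obtain ⟨n, rfl⟩ : ∃ n, q = n + 1 := ⟨q - 1, by omega⟩
    have := sum_inv_sq_range_le n
    have h0 : (0 : ℝ) ≤ (n : ℝ)⁻¹ := by positivity
    rw [mul_comm]
    gcongr
    linarith
  calc ∑ j ∈ Finset.range q, sqKer ((j : ℝ) / q)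
      = ∑ j ∈ Finset.range q, v ((j : ℝ) / q) + ∑ j ∈ Finset.range q, v (-((j : ℝ) / q)) := by
        rw [← Finset.sum_add_distrib]; rfl
    _ ≤ _ := by rw [h]; linarith

/-- Birkhoff-type sums of `oddKer` along the rational rotation by `p / q`. -/
def kerSum (p : ℤ) (q N : ℕ) : ℝ := ∑ m ∈ Finset.range N, oddKer (((m * p : ℤ) : ℝ) / q)

lemma kerSum_self {p : ℤ} {q : ℕ} (hq : 0 < q) (hp : IsCoprime p (q : ℤ)) : kerSum p q q = 0 := by
  have h := sum_periodic_reindex oddKer_periodic hq hp 0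
  simp only [sub_zero] at h
  rw [kerSum, h, sum_oddKer_div q hq]

lemma oddKer_natCast_add (p : ℤ) {q : ℕ} (hq : 0 < q) (m : ℕ) :
    oddKer (((((q + m : ℕ) : ℤ) * p : ℤ) : ℝ) / q) = oddKer (((m * p : ℤ) : ℝ) / q) := by
  apply periodic_div_of_modEq oddKer_periodic hq
  apply Int.ModEq.symm
  rw [Int.modEq_iff_dvd]
  exact ⟨p, by push_cast; ring⟩

lemma kerSum_add_self {p : ℤ} {q : ℕ} (hq : 0 < q) (hp : IsCoprime p (q : ℤ)) (N : ℕ) :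
    kerSum p q (q + N) = kerSum p q N := by
  have h := Finset.sum_range_add (fun m : ℕ => oddKer (((m * p : ℤ) : ℝ) / q)) q N
  have h0 := kerSum_self hq hp
  unfold kerSum at *
  rw [h, h0, zero_add]
  exact Finset.sum_congr rfl fun m _ => oddKer_natCast_add p hq m

lemma kerSum_mod {p : ℤ} {q : ℕ} (hq : 0 < q) (hp : IsCoprime p (q : ℤ)) (N : ℕ) :
    kerSum p q N = kerSum p q (N % q) := by
  have : ∀ b r, kerSum p q (q * b + r) = kerSum p q r := by
    intro b r
    induction b with
    | zero => simp
    | succ b ih => rw [mul_add, mul_one, add_comm (q * b), add_assoc, kerSum_add_self hq hp, ih]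
  conv_lhs => rw [← Nat.div_add_mod N q]
  exact this _ _

lemma oddKer_reflect (p : ℤ) {q : ℕ} (hq : 0 < q) {m : ℕ} (hm : m ≤ q) :
    oddKer (((((q - m : ℕ) : ℤ) * p : ℤ) : ℝ) / q) = -oddKer (((m * p : ℤ) : ℝ) / q) := by
  rw [← oddKer_neg, ← neg_div, ← Int.cast_neg]
  apply periodic_div_of_modEq oddKer_periodic hq
  apply Int.ModEq.symm
  rw [Int.modEq_iff_dvd]
  exact ⟨p, by push_cast [hm]; ring⟩

lemma kerSum_reflect {p : ℤ} {q : ℕ} (hq : 0 < q) (hp : IsCoprime p (q : ℤ)) (N : ℕ)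
    (hN : N ≤ q + 1) : kerSum p q N = kerSum p q (q + 1 - N) := by
  induction N with
  | zero =>
    rw [Nat.sub_zero, kerSum_add_self hq hp]
    simp [kerSum, oddKer_zero]
  | succ N ih =>
    have e : q + 1 - N = (q - N) + 1 := by omega
    have h := ih (by omega)
    rw [e] at h
    have e2 : q + 1 - (N + 1) = q - N := by omega
    rw [e2]
    have h2 := oddKer_reflect p hq (m := N) (by omega)
    unfold kerSum at *
    rw [Finset.sum_range_succ] at h ⊢
    rw [h, h2]; ring

lemma sum_sqKer_range_le {p : ℤ} {q : ℕ} (hq : 0 < q) (hp : IsCoprime p (q : ℤ)) (N : ℕ) :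
    ∑ m ∈ Finset.range N, sqKer (((m * p : ℤ) : ℝ) / q) ≤ ((N / q : ℕ) + 1) * (4 * (q : ℝ) ^ 2) := by
  have hblock : ∀ b, ∑ m ∈ Finset.range (b * q), sqKer (((m * p : ℤ) : ℝ) / q)
      ≤ b * (4 * (q : ℝ) ^ 2) := by
    intro b
    induction b with
    | zero => simp
    | succ b ih =>
      rw [add_mul, one_mul, Finset.sum_range_add]
      have e : ∀ m : ℕ, sqKer (((((b * q + m : ℕ) : ℤ) * p : ℤ) : ℝ) / q)
          = sqKer (((m * p : ℤ) : ℝ) / q) := by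
        intro m
        apply periodic_div_of_modEq sqKer_periodic hq
        apply Int.ModEq.symm
        rw [Int.modEq_iff_dvd]
        exact ⟨b * p, by push_cast; ring⟩
      simp only [e]
      have h := sum_periodic_reindex sqKer_periodic hq hp 0
      simp only [sub_zero] at h
      rw [h]
      have := sum_sqKer_div_le q hq
      rw [Nat.cast_add, Nat.cast_one, add_mul, one_mul]
      exact add_le_add ih this
  have hsub : Finset.range N ⊆ Finset.range ((N / q + 1) * q) := by
    intro m hm
    simp only [Finset.mem_range] at *
    have := Nat.lt_div_mul_add hq (a := N)
    rw [add_mul, one_mul]; omega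
  refine (Finset.sum_le_sum_of_subset_of_nonneg hsub fun _ _ _ => sqKer_nonneg _).trans ?_
  exact_mod_cast hblock (N / q + 1)

lemma abs_oddKer_le {s q : ℕ} (hs : 2 * s ≤ q) (hs0 : 0 < s) :
    |oddKer ((s : ℝ) / q)| ≤ q * (s : ℝ)⁻¹ := by
  have hq : (0 : ℝ) < q := by exact_mod_cast (by omega : 0 < q)
  have hs' : (0 : ℝ) < s := by exact_mod_cast hs0
  have hsq : 2 * (s : ℝ) ≤ q := by exact_mod_cast hs
  have hf : Int.fract ((s : ℝ) / q) = (s : ℝ) / q :=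
    Int.fract_eq_self.2 ⟨by positivity, (div_lt_one hq).2 (by linarith)⟩
  have hu : (0 : ℝ) < (s : ℝ) / q := by positivity
  have hu2 : (s : ℝ) / q ≤ 1 / 2 := by rw [div_le_div_iff₀ hq two_pos]; linarith
  unfold oddKer
  rw [Int.fract_neg (by rw [hf]; exact hu.ne'), hf]
  have h1 : (1 - (s : ℝ) / q)⁻¹ ≤ ((s : ℝ) / q)⁻¹ := by gcongr; linarith
  have h2 : 0 ≤ (1 - (s : ℝ) / q)⁻¹ := by rw [inv_nonneg]; linarith
  rw [abs_of_nonneg (by linarith)]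
  have h3 : ((s : ℝ) / q)⁻¹ = q * (s : ℝ)⁻¹ := by rw [inv_div, div_eq_mul_inv]
  linarith

lemma sum_inv_le_one_add_log (n : ℕ) :
    ∑ s ∈ Finset.range (n + 1), (s : ℝ)⁻¹ ≤ 1 + Real.log n := by
  have h := harmonic_le_one_add_log n
  rw [Finset.sum_range_succ']
  simpa [harmonic] using h

/-- Comparing the kernel sums of two consecutive convergents. -/
lemma abs_kerSum_le_succ {p p' : ℤ} {q q' a : ℕ} {ε : ℤ} (hε : |ε| = 1)
    (hdet : p * q' - p' * q = ε) (hq' : 0 < q') (hqq : q' ≤ q) (hqa : q ≤ (a + 1) * q')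
    (ha : 0 < a) {B : ℝ} (hB : ∀ N, |kerSum p' q' N| ≤ B) (N : ℕ) :
    |kerSum p q N| ≤ 13 * q * (1 + Real.log a) + B := by
  have hq : 0 < q := by omega
  have hεε : ε * ε = 1 := by rw [← abs_mul_abs_self, hε, one_mul]
  have hp : IsCoprime p (q : ℤ) := ⟨ε * q', -(ε * p'), by linear_combination ε * hdet + hεε⟩
  have hp' : IsCoprime p' (q' : ℤ) := ⟨-(ε * q), ε * p, by linear_combination ε * hdet + hεε⟩
  have hqR : (0 : ℝ) < q := by exact_mod_cast hq
  have hqR' : (0 : ℝ) < q' := by exact_mod_cast hq'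
  have hεR : |(ε : ℝ)| = 1 := by exact_mod_cast hε
  suffices H : ∀ N, 2 * N ≤ q + 1 → |kerSum p q N| ≤ 13 * q * (1 + Real.log a) + B by
    rw [kerSum_mod hq hp]
    have hlt := Nat.mod_lt N hq
    by_cases h : 2 * (N % q) ≤ q + 1
    · exact H _ h
    · rw [kerSum_reflect hq hp _ (by omega)]
      exact H _ (by omega)
  clear N
  intro N hN
  have hshift : ∀ m : ℕ, ((m * p : ℤ) : ℝ) / q
      = ((m * p' : ℤ) : ℝ) / q' + ε * m / (q * q') := by
    intro m
    have : (p : ℝ) * q' - p' * q = ε := by exact_mod_cast hdet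
    push_cast
    field_simp
    linear_combination (m : ℝ) * this
  let S := (Finset.range N).filter fun m => q' ∣ m
  let T := (Finset.range N).filter fun m => ¬ q' ∣ m
  have hdvd : ∀ m ∈ S, oddKer (((m * p' : ℤ) : ℝ) / q') = 0 := by
    intro m hm
    obtain ⟨s, hs⟩ := (Finset.mem_filter.1 hm).2
    have : ((m * p' : ℤ) : ℝ) / q' = ((s * p' : ℤ) : ℝ) := by
      rw [hs]; push_cast; field_simp
    rw [this, periodic_int oddKer_periodic, oddKer_zero]
  have hsplit : kerSum p q N = ∑ m ∈ S, oddKer (((m * p : ℤ) : ℝ) / q)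
      + ∑ m ∈ T, (oddKer (((m * p : ℤ) : ℝ) / q) - oddKer (((m * p' : ℤ) : ℝ) / q'))
      + kerSum p' q' N := by
    rw [Finset.sum_sub_distrib, kerSum, kerSum,
      ← Finset.sum_filter_add_sum_filter_not (Finset.range N) (fun m => q' ∣ m),
      ← Finset.sum_filter_add_sum_filter_not (Finset.range N) (fun m => q' ∣ m)
        (fun m : ℕ => oddKer (((m * p' : ℤ) : ℝ) / q')), Finset.sum_eq_zero hdvd]
    ring
  have hloga : 0 ≤ Real.log a := Real.log_natCast_nonneg a
  have hS : |∑ m ∈ S, oddKer (((m * p : ℤ) : ℝ) / q)| ≤ q * (1 + Real.log a) := by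
    refine (Finset.abs_sum_le_sum_abs _ _).trans ?_
    have hsub : S ⊆ (Finset.range (a + 1)).image (fun s => q' * s) := by
      intro m hm
      obtain ⟨hm1, s, rfl⟩ := Finset.mem_filter.1 hm
      refine Finset.mem_image.2 ⟨s, ?_, rfl⟩
      rw [Finset.mem_range] at *
      have : 2 * (q' * s) ≤ (a + 1) * q' := by omega
      have : 2 * s ≤ a + 1 := by
        by_contra h
        have : q' * (a + 1) < q' * (2 * s) := Nat.mul_lt_mul_of_pos_left (by omega) hq'
        nlinarith
      omega
    have hterm : ∀ m ∈ S, |oddKer (((m * p : ℤ) : ℝ) / q)| ≤ q * ((m / q' : ℕ) : ℝ)⁻¹ := by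
      intro m hm
      obtain ⟨hm1, s, rfl⟩ := Finset.mem_filter.1 hm
      rw [Finset.mem_range] at hm1
      rw [Nat.mul_div_cancel_left s hq']
      rcases Nat.eq_zero_or_pos s with rfl | hs
      · simp [oddKer_zero]
      have e : (((q' * s : ℕ) * p : ℤ) : ℝ) / q = ε * ((s : ℝ) / q) + ((s * p' : ℤ) : ℝ) := by
        have : (p : ℝ) * q' - p' * q = ε := by exact_mod_cast hdet
        push_cast
        field_simp
        linear_combination this
      have hle : 2 * s ≤ q := by nlinarith
      rw [e, periodic_add_int oddKer_periodic]
      have h := abs_oddKer_le hle hs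
      rcases (abs_eq (by norm_num : (0 : ℤ) ≤ 1)).1 hε with h1 | h1 <;> rw [h1]
      · simpa using h
      · simpa [oddKer_neg] using h
    have hinj : Set.InjOn (fun s => q' * s) (Finset.range (a + 1) : Set ℕ) :=
      fun x _ y _ h => Nat.eq_of_mul_eq_mul_left hq' h
    refine (Finset.sum_le_sum hterm).trans ((Finset.sum_le_sum_of_subset_of_nonneg hsub
      fun _ _ _ => by positivity).trans ?_)
    rw [Finset.sum_image hinj, ← Finset.mul_sum]
    simp only [Nat.mul_div_cancel_left _ hq']
    have := sum_inv_le_one_add_log a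
    gcongr
  have hT : |∑ m ∈ T, (oddKer (((m * p : ℤ) : ℝ) / q) - oddKer (((m * p' : ℤ) : ℝ) / q'))|
      ≤ 12 * q := by
    have hterm : ∀ m ∈ T, |oddKer (((m * p : ℤ) : ℝ) / q) - oddKer (((m * p' : ℤ) : ℝ) / q')|
        ≤ 3 / (2 * q') * sqKer (((m * p' : ℤ) : ℝ) / q') := by
      intro m hm
      obtain ⟨hm1, hm2⟩ := Finset.mem_filter.1 hm
      rw [Finset.mem_range] at hm1
      have hnd : ¬ (q' : ℤ) ∣ m * p' := fun h => hm2 (by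
        exact_mod_cast hp'.symm.dvd_of_dvd_mul_right h)
      have hs : |(ε : ℝ) * m / (q * q')| ≤ 1 / (2 * q') := by
        rw [abs_div, abs_mul, hεR, one_mul, Nat.abs_cast,
          abs_of_pos (by positivity : (0 : ℝ) < q * q'), div_le_div_iff₀ (by positivity)
          (by positivity)]
        have : 2 * (m : ℝ) ≤ q := by exact_mod_cast (by omega : 2 * m ≤ q)
        nlinarith
      rw [hshift]
      refine (oddKer_add_sub_le (inv_le_fract_of_not_dvd hq' hnd)
        (inv_le_fract_neg_of_not_dvd hq' hnd) (by positivity) (hs.trans ?_)).trans ?_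
      · rw [one_div, mul_inv]; gcongr; norm_num
      · have := sqKer_nonneg (((m * p' : ℤ) : ℝ) / q')
        calc _ ≤ 3 * (1 / (2 * q')) * sqKer (((m * p' : ℤ) : ℝ) / q') := by gcongr
          _ = _ := by ring
    refine (Finset.abs_sum_le_sum_abs _ _).trans ((Finset.sum_le_sum hterm).trans ?_)
    rw [← Finset.mul_sum]
    have h1 : ∑ m ∈ T, sqKer (((m * p' : ℤ) : ℝ) / q')
        ≤ ((N / q' : ℕ) + 1) * (4 * (q' : ℝ) ^ 2) :=
      (Finset.sum_le_sum_of_subset_of_nonneg (Finset.filter_subset _ _)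
        fun _ _ _ => sqKer_nonneg _).trans (sum_sqKer_range_le hq' hp' N)
    have h2 : ((N / q' : ℕ) : ℝ) * q' ≤ N := by exact_mod_cast Nat.div_mul_le_self N q'
    have h3 : (N : ℝ) ≤ q := by exact_mod_cast (by omega : N ≤ q)
    have h4 : (q' : ℝ) ≤ q := by exact_mod_cast hqq
    calc _ ≤ 3 / (2 * (q' : ℝ)) * (((N / q' : ℕ) + 1) * (4 * (q' : ℝ) ^ 2)) := by gcongr
      _ = 6 * (((N / q' : ℕ) : ℝ) * q' + q') := by field_simp; ring
      _ ≤ _ := by linarith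
  rw [hsplit]
  have hBN := hB N
  have : |∑ m ∈ S, oddKer (((m * p : ℤ) : ℝ) / q)
      + ∑ m ∈ T, (oddKer (((m * p : ℤ) : ℝ) / q) - oddKer (((m * p' : ℤ) : ℝ) / q'))
      + kerSum p' q' N| ≤ _ := abs_add_three _ _ _
  have hql : 0 ≤ q * Real.log a := by positivity
  linarith

/-- The numerators of the convergents of the continued fraction of `α`. -/
def cfP (α : ℝ) : ℕ → ℤ
  | 0 => 0
  | 1 => 1
  | n + 2 => cfA α (n + 2) * cfP α (n + 1) + cfP α n

lemma gaussIter_succ (α : ℝ) (n : ℕ) : gaussIter α (n + 1) = Int.fract (gaussIter α n)⁻¹ := by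
  simp only [gaussIter, Function.iterate_succ_apply']

lemma irrational_fract {x : ℝ} (hx : Irrational x) : Irrational (Int.fract x) := by
  have : x - ⌊x⌋ = Int.fract x := Int.self_sub_floor x
  rw [← this]; exact hx.sub_intCast _

lemma irrational_gaussIter {α : ℝ} (hα : Irrational α) (n : ℕ) : Irrational (gaussIter α n) := by
  induction n with
  | zero => exact irrational_fract hα
  | succ n ih => rw [gaussIter_succ]; exact irrational_fract (irrational_inv_iff.2 ih)

lemma gaussIter_mem {α : ℝ} (hα : Irrational α) (n : ℕ) :
    0 < gaussIter α n ∧ gaussIter α n < 1 := by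
  have h : 0 ≤ gaussIter α n ∧ gaussIter α n < 1 := by
    cases n with
    | zero => exact ⟨Int.fract_nonneg _, Int.fract_lt_one _⟩
    | succ n => rw [gaussIter_succ]; exact ⟨Int.fract_nonneg _, Int.fract_lt_one _⟩
  exact ⟨h.1.lt_of_ne (irrational_gaussIter hα n).ne_zero.symm, h.2⟩

lemma cfA_pos {α : ℝ} (hα : Irrational α) (n : ℕ) : 0 < cfA α (n + 1) := by
  obtain ⟨h0, h1⟩ := gaussIter_mem hα n
  rw [cfA, Nat.floor_pos]
  exact (one_lt_inv₀ h0).2 h1 |>.le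

lemma gaussIter_succ_eq {α : ℝ} (hα : Irrational α) (n : ℕ) :
    gaussIter α (n + 1) = (gaussIter α n)⁻¹ - cfA α (n + 1) := by
  obtain ⟨h0, h1⟩ := gaussIter_mem hα n
  rw [gaussIter_succ, cfA, Nat.add_sub_cancel, natCast_floor_eq_intCast_floor (by positivity),
    Int.self_sub_floor]

lemma cfQ_add_two (α : ℝ) (n : ℕ) :
    cfQ α (n + 1 + 1) = cfA α (n + 1 + 1) * cfQ α (n + 1) + cfQ α n := rfl

lemma cfQ_pos {α : ℝ} (hα : Irrational α) (n : ℕ) : 0 < cfQ α n := by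
  have : 0 < cfQ α n ∧ 0 < cfQ α (n + 1) := by
    induction n with
    | zero => exact ⟨one_pos, cfA_pos hα 0⟩
    | succ n ih => exact ⟨ih.2, by rw [cfQ]; exact Nat.add_pos_right _ ih.1⟩
  exact this.1

lemma cfQ_succ_bounds {α : ℝ} (hα : Irrational α) (n : ℕ) :
    cfA α (n + 1) * cfQ α n ≤ cfQ α (n + 1) ∧
      cfQ α (n + 1) ≤ (cfA α (n + 1) + 1) * cfQ α n := by
  have hmono : ∀ n, cfQ α n ≤ cfQ α (n + 1) := by
    intro n
    cases n with
    | zero => exact cfA_pos hα 0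
    | succ n =>
      rw [cfQ]
      nlinarith [cfA_pos hα (n + 1), cfQ_pos hα (n + 1)]
  cases n with
  | zero => simp [cfQ]
  | succ n =>
    have := hmono n
    rw [cfQ_add_two]
    constructor
    · omega
    · rw [add_mul, one_mul]; omega

lemma cfQ_le_succ {α : ℝ} (hα : Irrational α) (n : ℕ) : cfQ α n ≤ cfQ α (n + 1) := by
  have h := (cfQ_succ_bounds hα n).1
  nlinarith [cfA_pos hα n]

lemma cf_det (α : ℝ) (n : ℕ) :
    cfP α (n + 1) * cfQ α n - cfP α n * cfQ α (n + 1) = (-1) ^ n := by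
  induction n with
  | zero => simp [cfP, cfQ]
  | succ n ih =>
    rw [cfP, cfQ, pow_succ, ← ih]
    push_cast
    ring

lemma cf_residual {α : ℝ} (hα : Irrational α) (h01 : α ∈ Set.Ioo (0 : ℝ) 1) (n : ℕ) :
    cfQ α (n + 1) * α - cfP α (n + 1) = -gaussIter α (n + 1) * (cfQ α n * α - cfP α n) := by
  induction n with
  | zero =>
    have h0 : gaussIter α 0 = α := Int.fract_eq_self.2 ⟨h01.1.le, h01.2⟩
    have := h01.1.ne'
    rw [gaussIter_succ_eq hα, h0]
    simp only [cfP, cfQ]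
    push_cast
    field_simp
    ring
  | succ n ih =>
    have h0 := (gaussIter_mem hα (n + 1)).1.ne'
    rw [gaussIter_succ_eq hα (n + 1), cfP, cfQ]
    have e : (cfQ α n * α - cfP α n : ℝ)
        = -(gaussIter α (n + 1))⁻¹ * (cfQ α (n + 1) * α - cfP α (n + 1)) := by
      rw [ih]; field_simp
    push_cast
    linear_combination e

lemma abs_sub_cf_le {α : ℝ} (hα : Irrational α) (h01 : α ∈ Set.Ioo (0 : ℝ) 1) (n : ℕ) :
    |α - cfP α n / cfQ α n| ≤ 1 / (cfQ α n * cfQ α (n + 1)) := by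
  have hq : (0 : ℝ) < cfQ α n := by exact_mod_cast cfQ_pos hα n
  have hq1 : (0 : ℝ) < cfQ α (n + 1) := by exact_mod_cast cfQ_pos hα (n + 1)
  have hx := (gaussIter_mem hα (n + 1)).1
  have hdet : (cfP α (n + 1) * cfQ α n - cfP α n * cfQ α (n + 1) : ℝ) = (-1) ^ n := by
    exact_mod_cast cf_det α n
  have hres := cf_residual hα h01 n
  have key : (cfQ α n * α - cfP α n : ℝ) * (cfQ α (n + 1) + gaussIter α (n + 1) * cfQ α n)
      = (-1) ^ n := by
    rw [← hdet]; linear_combination (cfQ α n : ℝ) * hres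
  have habs := congrArg abs key
  rw [abs_mul, abs_pow, abs_neg, abs_one, one_pow,
    abs_of_pos (by positivity : 0 < cfQ α (n + 1) + gaussIter α (n + 1) * (cfQ α n : ℝ))] at habs
  have hle : |(cfQ α n * α - cfP α n : ℝ)| * cfQ α (n + 1) ≤ 1 := by
    rw [← habs]; gcongr
    linarith [mul_pos hx hq]
  have e : α - cfP α n / cfQ α n = (cfQ α n * α - cfP α n) / cfQ α n := by field_simp
  rw [e, abs_div, abs_of_pos hq, div_le_div_iff₀ hq (by positivity)]
  nlinarith

lemma cf_isCoprime (α : ℝ) (n : ℕ) : IsCoprime (cfP α n) (cfQ α n : ℤ) := by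
  refine ⟨-((-1) ^ n * cfQ α (n + 1)), (-1) ^ n * cfP α (n + 1), ?_⟩
  have h : ((-1 : ℤ) ^ n) * (-1) ^ n = 1 := by rw [← mul_pow]; simp
  linear_combination (-1) ^ n * cf_det α n + h

/-- The denominators `q_n + q_{n-1}`, with `q_{-1} = 0`; they grow at least like `(3/2) ^ n`. -/
def cfR (α : ℝ) : ℕ → ℕ
  | 0 => 1
  | n + 1 => cfQ α (n + 1) + cfQ α n

lemma cfQ_le_cfR (α : ℝ) (n : ℕ) : cfQ α n ≤ cfR α n := by
  cases n <;> simp [cfQ, cfR]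

lemma cfR_le {α : ℝ} (hα : Irrational α) (n : ℕ) : cfR α n ≤ 2 * cfQ α n := by
  cases n with
  | zero => simp [cfQ, cfR]
  | succ n => rw [cfR]; linarith [cfQ_le_succ hα n]

lemma three_mul_cfR_le {α : ℝ} (hα : Irrational α) (n : ℕ) : 3 * cfR α n ≤ 2 * cfR α (n + 1) := by
  cases n with
  | zero =>
    have := cfA_pos hα 0
    simp only [cfR, cfQ, zero_add] at *; omega
  | succ n =>
    have h1 := cfQ_le_succ hα n
    have h2 : cfQ α (n + 1) + cfQ α n ≤ cfQ α (n + 1 + 1) := by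
      rw [cfQ_add_two]; nlinarith [cfA_pos hα (n + 1)]
    simp only [cfR]; omega

lemma abs_kerSum_cf_le {α : ℝ} (hα : Irrational α) {c : ℝ} (hc : 0 < c) {n : ℕ}
    (hdio : ∀ i : ℕ, 1 ≤ i → i ≤ n → (cfA α (n + 1 - i) : ℝ) ≤ Real.exp (c * i)) (N : ℕ) :
    |kerSum (cfP α n) (cfQ α n) N| ≤ 26 * (3 + 9 * c) * cfQ α n := by
  have H : ∀ j ≤ n, ∀ N, |kerSum (cfP α j) (cfQ α j) N|
      ≤ 13 * cfR α j * (3 + 6 * c + 3 * c * (n + 1 - j)) := by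
    intro j
    induction j with
    | zero =>
      intro _ N
      have : kerSum (cfP α 0) (cfQ α 0) N = 0 := by
        simp [kerSum, cfP, oddKer_zero]
      rw [this, abs_zero]
      push_cast
      rw [sub_zero]
      positivity
    | succ j ih =>
      intro hj N
      have hjn : (j : ℝ) + 1 ≤ n := by exact_mod_cast hj
      have hR : (3 * cfR α j : ℝ) ≤ 2 * cfR α (j + 1) := by exact_mod_cast three_mul_cfR_le hα j
      have hQR : (cfQ α (j + 1) : ℝ) ≤ cfR α (j + 1) := by exact_mod_cast cfQ_le_cfR α (j + 1)
      have hlog : Real.log (cfA α (j + 1)) ≤ c * (n - j) := by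
        rw [Real.log_le_iff_le_exp (by exact_mod_cast cfA_pos hα j)]
        have h := hdio (n - j) (by omega) (by omega)
        rw [show n + 1 - (n - j) = j + 1 by omega, Nat.cast_sub (by omega)] at h
        exact h
      have h := abs_kerSum_le_succ (p := cfP α (j + 1)) (p' := cfP α j) (q := cfQ α (j + 1))
        (q' := cfQ α j) (a := cfA α (j + 1)) (ε := (-1) ^ j) (by simp) (cf_det α j)
        (cfQ_pos hα j) (cfQ_le_succ hα j) (cfQ_succ_bounds hα j).2 (cfA_pos hα j)
        (ih (by omega)) N
      have hnn : 0 ≤ c * (n - j) := mul_nonneg hc.le (by linarith)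
      have hR0 : (0 : ℝ) ≤ cfR α (j + 1) := by positivity
      have e1 : 13 * (cfQ α (j + 1) : ℝ) * (1 + Real.log (cfA α (j + 1)))
          ≤ 13 * cfR α (j + 1) * (1 + c * (n - j)) := by
        have := Real.log_natCast_nonneg (cfA α (j + 1))
        gcongr
      have e2 : 13 * (cfR α j : ℝ) * (3 + 6 * c + 3 * c * (n + 1 - j))
          ≤ 13 * (2 / 3 * cfR α (j + 1)) * (3 + 6 * c + 3 * c * (n + 1 - j)) := by
        have : 0 ≤ 3 + 6 * c + 3 * c * (n + 1 - j) := by nlinarith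
        gcongr
        linarith
      refine h.trans ((add_le_add e1 e2).trans (le_of_eq ?_))
      push_cast
      ring
  have h := H n le_rfl N
  have hR : (cfR α n : ℝ) ≤ 2 * cfQ α n := by exact_mod_cast cfR_le hα n
  refine h.trans ?_
  calc _ = 13 * (cfR α n : ℝ) * (3 + 9 * c) := by ring
    _ ≤ 13 * (2 * cfQ α n) * (3 + 9 * c) := by gcongr
    _ = _ := by ring

lemma sum_natCast_mul_range (e : ℕ → ℝ) (N : ℕ) :
    ∑ i ∈ Finset.range N, (i : ℝ) * e i
      = N * ∑ i ∈ Finset.range N, e i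
        - ∑ l ∈ Finset.range N, ∑ i ∈ Finset.range (l + 1), e i := by
  induction N with
  | zero => simp
  | succ N ih =>
    rw [Finset.sum_range_succ, ih, Finset.sum_range_succ (fun l => ∑ i ∈ Finset.range (l + 1), e i),
      Finset.sum_range_succ e]
    push_cast
    ring

lemma abs_sum_mul_oddKer_le {p : ℤ} {q : ℕ} (hq : 0 < q) (hp : IsCoprime p (q : ℤ)) {Γ : ℝ}
    (hΓ : ∀ N, |kerSum p q N| ≤ Γ * q) {i₀ : ℕ} (hi₀ : i₀ < q) :
    |∑ i ∈ Finset.range q, (i : ℝ) * oddKer (((((i : ℤ) - i₀) * p : ℤ) : ℝ) / q)|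
      ≤ 2 * Γ * (q : ℝ) ^ 2 := by
  set e : ℕ → ℝ := fun i => oddKer (((((i : ℤ) - i₀) * p : ℤ) : ℝ) / q)
  have hE : ∀ N, |∑ i ∈ Finset.range N, e i| ≤ 2 * Γ * q := by
    intro N
    have h : kerSum p q (q - i₀ + N) = kerSum p q (q - i₀) + ∑ i ∈ Finset.range N, e i := by
      rw [kerSum, Finset.sum_range_add]
      congr 1
      refine Finset.sum_congr rfl fun i _ => ?_
      apply periodic_div_of_modEq oddKer_periodic hq
      apply Int.ModEq.symm
      rw [Int.modEq_iff_dvd]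
      exact ⟨p, by push_cast [hi₀.le]; ring⟩
    have h1 := abs_le.1 (hΓ (q - i₀ + N))
    have h2 := abs_le.1 (hΓ (q - i₀))
    rw [abs_le]
    constructor <;> linarith [h1.1, h1.2, h2.1, h2.2]
  have h0 : ∑ i ∈ Finset.range q, e i = 0 := by
    rw [← sum_oddKer_div q hq]
    exact sum_periodic_reindex oddKer_periodic hq hp (i₀ : ℤ)
  rw [sum_natCast_mul_range e, h0, mul_zero, zero_sub, abs_neg]
  refine (Finset.abs_sum_le_sum_abs _ _).trans
    ((Finset.sum_le_sum fun l _ => hE (l + 1)).trans (le_of_eq ?_))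
  rw [Finset.sum_const, Finset.card_range, nsmul_eq_mul]
  ring

/-- If `x + i₀ α` is the orbit point nearest to an integer, then the Birkhoff sum of the roof
is the singular term at `x + i₀ α` plus a quantity that is constant up to a bounded error. -/
lemma abs_birkhoffRot_sub_le {α : ℝ} {p : ℤ} {q : ℕ} (hq : 0 < q) (hp : IsCoprime p (q : ℤ))
    {Γ : ℝ} (hΓ : ∀ N, |kerSum p q N| ≤ Γ * q) (hη : |α - p / q| ≤ 1 / (100 * (q : ℝ) ^ 2))
    {g : ℝ → ℝ} (hgper : Function.Periodic g 1) {ℓ : ℝ} (hℓ : ∀ x y, |g x - g y| ≤ ℓ * |x - y|)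
    {i₀ : ℕ} (hi₀ : i₀ < q) (z : ℤ) {x : ℝ} (hx : |x + i₀ * α - z| ≤ 51 / 100 * (q : ℝ)⁻¹) :
    |birkhoffRot α (symLogRoof g) q x - symLog (x + i₀ * α)
      - (∑ j ∈ Finset.range q, symLog ((j : ℝ) / q) + ∑ j ∈ Finset.range q, g ((j : ℝ) / q))|
      ≤ 4 + Γ + ℓ := by
  have hqR : (0 : ℝ) < q := by exact_mod_cast hq
  have hℓ0 : 0 ≤ ℓ := by
    have := (abs_nonneg _).trans (hℓ 1 0)
    simpa using this
  have hΓ0 : 0 ≤ Γ := by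
    have := (abs_nonneg _).trans (hΓ 0)
    exact nonneg_of_mul_nonneg_left this hqR
  set η := α - p / q with hηdef
  set s := x + i₀ * α - z with hs
  set y : ℕ → ℝ := fun i => ((((i : ℤ) - i₀) * p : ℤ) : ℝ) / q with hy
  set t : ℕ → ℝ := fun i => s + ((i : ℝ) - i₀) * η with ht
  have hxi : ∀ i : ℕ, x + i * α = y i + t i + z := by
    intro i
    have h1 : α = p / q + η := by rw [hηdef]; ring
    have h2 : x = s - i₀ * α + z := by rw [hs]; ring
    simp only [hy, ht]
    rw [h2, h1]
    push_cast
    field_simp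
    ring
  have hti : ∀ i ∈ Finset.range q, |t i| ≤ 52 / 100 * (q : ℝ)⁻¹ := by
    intro i hi
    rw [Finset.mem_range] at hi
    have h1 : |(i : ℝ) - i₀| ≤ q := by
      have hi' : (i : ℝ) < q := by exact_mod_cast hi
      have hi₀' : (i₀ : ℝ) < q := by exact_mod_cast hi₀
      have := Nat.cast_nonneg (α := ℝ) i
      have := Nat.cast_nonneg (α := ℝ) i₀
      rw [abs_le]; constructor <;> linarith
    calc |t i| ≤ |s| + |((i : ℝ) - i₀) * η| := abs_add_le _ _
      _ ≤ 51 / 100 * (q : ℝ)⁻¹ + q * (1 / (100 * (q : ℝ) ^ 2)) := by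
        rw [abs_mul]; gcongr
      _ = _ := by field_simp; norm_num
  have hκ : ∑ i ∈ Finset.range q, oddKer (y i) = 0 := by
    rw [← sum_oddKer_div q hq]
    exact sum_periodic_reindex oddKer_periodic hq hp (i₀ : ℤ)
  have hsq : ∑ i ∈ Finset.range q, sqKer (y i) ≤ 4 * (q : ℝ) ^ 2 := by
    have h : ∑ i ∈ Finset.range q, sqKer (y i) = ∑ j ∈ Finset.range q, sqKer ((j : ℝ) / q) :=
      sum_periodic_reindex sqKer_periodic hq hp (i₀ : ℤ)
    rw [h]; exact sum_sqKer_div_le q hq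
  have hlogs : ∑ i ∈ Finset.range q, symLog (y i) = ∑ j ∈ Finset.range q, symLog ((j : ℝ) / q) :=
    sum_periodic_reindex symLog_periodic hq hp (i₀ : ℤ)
  have hgs : ∑ i ∈ Finset.range q, g (y i) = ∑ j ∈ Finset.range q, g ((j : ℝ) / q) :=
    sum_periodic_reindex hgper hq hp (i₀ : ℤ)
  have hlin : |∑ i ∈ Finset.range q, t i * oddKer (y i)| ≤ Γ := by
    have e : ∑ i ∈ Finset.range q, t i * oddKer (y i)
        = η * ∑ i ∈ Finset.range q, (i : ℝ) * oddKer (y i) := by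
      have : ∀ i, t i * oddKer (y i)
          = (s - i₀ * η) * oddKer (y i) + η * ((i : ℝ) * oddKer (y i)) := by
        intro i; simp only [ht]; ring
      simp only [this]
      rw [Finset.sum_add_distrib, ← Finset.mul_sum, ← Finset.mul_sum, hκ, mul_zero, zero_add]
    have h := abs_sum_mul_oddKer_le hq hp hΓ hi₀
    rw [e, abs_mul]
    calc _ ≤ 1 / (100 * (q : ℝ) ^ 2) * (2 * Γ * (q : ℝ) ^ 2) := by gcongr
      _ = Γ / 50 := by field_simp; ring
      _ ≤ Γ := by linarith
  have hgd : |∑ i ∈ Finset.range q, (g (x + i * α) - g (y i))| ≤ ℓ := by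
    refine (Finset.abs_sum_le_sum_abs _ _).trans ?_
    have : ∀ i ∈ Finset.range q, |g (x + i * α) - g (y i)| ≤ ℓ * (q : ℝ)⁻¹ := by
      intro i hi
      rw [hxi, periodic_add_int hgper]
      refine (hℓ _ _).trans ?_
      rw [add_sub_cancel_left]
      have := hti i hi
      have : (0 : ℝ) < (q : ℝ)⁻¹ := by positivity
      gcongr
      linarith
    refine (Finset.sum_le_sum this).trans (le_of_eq ?_)
    rw [Finset.sum_const, Finset.card_range, nsmul_eq_mul]
    field_simp
  have hsing : |∑ i ∈ (Finset.range q).erase i₀,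
      (symLog (x + i * α) - symLog (y i) + t i * oddKer (y i))| ≤ 4 := by
    refine (Finset.abs_sum_le_sum_abs _ _).trans ?_
    have : ∀ i ∈ (Finset.range q).erase i₀,
        |symLog (x + i * α) - symLog (y i) + t i * oddKer (y i)|
          ≤ (q : ℝ)⁻¹ ^ 2 * sqKer (y i) := by
      intro i hi
      obtain ⟨hne, hi'⟩ := Finset.mem_erase.1 hi
      have hnd : ¬ (q : ℤ) ∣ ((i : ℤ) - i₀) * p := by
        intro h
        have h3 : (q : ℤ) ∣ (i : ℤ) - i₀ := hp.symm.dvd_of_dvd_mul_right h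
        rw [Finset.mem_range] at hi'
        have := Int.eq_zero_of_abs_lt_dvd h3 (by rw [abs_lt]; omega)
        omega
      rw [hxi, periodic_add_int symLog_periodic]
      refine (symLog_add_sub_le (inv_le_fract_of_not_dvd hq hnd)
        (inv_le_fract_neg_of_not_dvd hq hnd) (by positivity) (hti i hi')).trans ?_
      have h0 := sqKer_nonneg (y i)
      have h2 : 3 * t i ^ 2 ≤ (q : ℝ)⁻¹ ^ 2 := by
        have h1 : t i ^ 2 ≤ (52 / 100 * (q : ℝ)⁻¹) ^ 2 :=
          sq_le_sq' (abs_le.1 (hti i hi')).1 (abs_le.1 (hti i hi')).2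
        have : 0 ≤ (q : ℝ)⁻¹ ^ 2 := by positivity
        nlinarith
      gcongr
    refine (Finset.sum_le_sum this).trans ?_
    rw [← Finset.mul_sum]
    have h1 : ∑ i ∈ (Finset.range q).erase i₀, sqKer (y i) ≤ 4 * (q : ℝ) ^ 2 :=
      (Finset.sum_le_sum_of_subset_of_nonneg (Finset.erase_subset _ _)
        fun _ _ _ => sqKer_nonneg _).trans hsq
    calc _ ≤ (q : ℝ)⁻¹ ^ 2 * (4 * (q : ℝ) ^ 2) := by gcongr
      _ = 4 := by field_simp
  have hy0 : y i₀ = 0 := by simp [hy]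
  have herase : ∑ i ∈ (Finset.range q).erase i₀,
      (symLog (x + i * α) - symLog (y i) + t i * oddKer (y i))
      = ∑ i ∈ Finset.range q, (symLog (x + i * α) - symLog (y i) + t i * oddKer (y i))
        - symLog (x + i₀ * α) := by
    rw [← Finset.add_sum_erase _ _ (Finset.mem_range.2 hi₀), hy0, symLog_zero, oddKer_zero]
    ring
  rw [herase, Finset.sum_add_distrib, Finset.sum_sub_distrib, hlogs] at hsing
  rw [Finset.sum_sub_distrib, hgs] at hgd
  have hB : birkhoffRot α (symLogRoof g) q x
      = ∑ i ∈ Finset.range q, symLog (x + i * α) + ∑ i ∈ Finset.range q, g (x + i * α) := by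
    simp only [birkhoffRot, symLogRoof, Finset.sum_add_distrib]
  rw [hB]
  rw [abs_le] at *
  constructor <;> linarith [hsing.1, hsing.2, hgd.1, hgd.2, hlin.1, hlin.2]

lemma exists_lipschitz_bound {g : ℝ → ℝ} (hgper : Function.Periodic g 1) (hg : ContDiff ℝ 1 g) :
    ∃ ℓ : ℝ, ∀ x y, |g x - g y| ≤ ℓ * |x - y| := by
  have hcont : Continuous (deriv g) := hg.continuous_deriv le_rfl
  have hper : Function.Periodic (deriv g) 1 := by
    intro x
    rw [← deriv_comp_add_const]
    congr 1
    exact funext hgper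
  obtain ⟨ℓ, hℓ⟩ := isCompact_Icc.exists_bound_of_continuousOn (s := Set.Icc (0 : ℝ) 1)
    hcont.continuousOn
  refine ⟨ℓ, fun x y => ?_⟩
  refine Convex.norm_image_sub_le_of_norm_deriv_le (s := Set.univ)
    (fun t _ => (hg.differentiable one_ne_zero) t) (fun t _ => ?_) convex_univ
    (Set.mem_univ y) (Set.mem_univ x)
  obtain ⟨u, hu, he⟩ := hper.exists_mem_Ico₀ one_pos t
  rw [he]
  exact hℓ u (Set.Ico_subset_Icc_self hu)

lemma abs_symLog_add_log_le {s : ℝ} (hs0 : s ≠ 0) (hs : |s| ≤ 51 / 100) :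
    |symLog s + Real.log (|s|)| ≤ 2 := by
  have hpos := abs_pos.2 hs0
  have e : symLog s + Real.log |s| = -Real.log (1 - |s|) := by
    rcases hs0.lt_or_gt with h | h
    · rw [abs_of_neg h] at *
      have : Int.fract s = 1 + s := by
        rw [Int.fract_eq_iff]; exact ⟨by linarith, by linarith, -1, by push_cast; ring⟩
      rw [symLog, this, show 1 - (1 + s) = -s by ring, show 1 - -s = 1 + s by ring]; ring
    · rw [abs_of_pos h] at *
      have : Int.fract s = s := Int.fract_eq_self.2 ⟨h.le, by linarith⟩
      rw [symLog, this]; ring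
  have hp : 0 < 1 - |s| := by linarith
  have l := Real.one_sub_inv_le_log_of_pos hp
  have u := Real.log_le_sub_one_of_pos hp
  have : (1 - |s|)⁻¹ ≤ 3 := by
    rw [inv_le_comm₀ hp (by norm_num)]; linarith
  rw [e, abs_le]
  constructor <;> linarith

lemma exists_orbit_dvd {p : ℤ} {q : ℕ} (hq : 0 < q) (hp : IsCoprime p (q : ℤ)) (u : ℤ) :
    ∃ i < q, ∃ z : ℤ, u + i * p = q * z := by
  obtain ⟨a, b, hab⟩ := hp
  have hq' : (0 : ℤ) < q := by exact_mod_cast hq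
  refine ⟨((-u * a) % q).toNat, ?_, ?_⟩
  · have := Int.emod_lt_of_pos (-u * a) hq'
    omega
  · rw [Int.toNat_of_nonneg (Int.emod_nonneg _ hq'.ne')]
    have h := Int.emod_add_mul_ediv (-u * a) q
    exact ⟨u * b - (-u * a) / q * p, by linear_combination p * h - u * hab⟩

lemma abs_natCast_mul_sub_le {η : ℝ} {q : ℕ} (hq : 0 < q) (hη : |η| ≤ 1 / (100 * (q : ℝ) ^ 2))
    {i : ℕ} (hi : i < q) : |i * η| ≤ 1 / 100 * (q : ℝ)⁻¹ := by
  have hqR : (0 : ℝ) < q := by exact_mod_cast hq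
  have hi' : (i : ℝ) ≤ q := by exact_mod_cast hi.le
  rw [abs_mul, Nat.abs_cast]
  calc _ ≤ (q : ℝ) * (1 / (100 * (q : ℝ) ^ 2)) := by gcongr
    _ = _ := by field_simp

lemma exists_orbit_near {α : ℝ} {p : ℤ} {q : ℕ} (hq : 0 < q) (hp : IsCoprime p (q : ℤ))
    (hη : |α - p / q| ≤ 1 / (100 * (q : ℝ) ^ 2)) (x : ℝ) :
    ∃ i < q, ∃ z : ℤ, |x + i * α - z| ≤ 51 / 100 * (q : ℝ)⁻¹ := by
  have hqR : (0 : ℝ) < q := by exact_mod_cast hq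
  have h1 := abs_sub_round ((q : ℝ) * x)
  generalize round ((q : ℝ) * x) = u at h1
  obtain ⟨i, hi, z, hz⟩ := exists_orbit_dvd hq hp u
  refine ⟨i, hi, z, ?_⟩
  have hz' : (u : ℝ) + i * p = q * z := by exact_mod_cast hz
  have e : x + i * α - z = (q * x - u) * (q : ℝ)⁻¹ + i * (α - p / q) := by
    field_simp
    linear_combination hz'
  rw [e]
  refine (abs_add_le _ _).trans ?_
  have h2 := abs_natCast_mul_sub_le hq hη hi
  rw [abs_mul, abs_of_pos (inv_pos.2 hqR)]
  have h3 : |(q : ℝ) * x - u| * (q : ℝ)⁻¹ ≤ 1 / 2 * (q : ℝ)⁻¹ := by gcongr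
  linarith

/-- Near a singularity, the deviation of the Birkhoff sum from its value at `1 / (2 q)` is
minus the logarithm of the normalised distance to the singularity, up to a bounded error. -/
lemma abs_birkhoffRot_sub_center_le {α : ℝ} {p : ℤ} {q : ℕ} (hq : 0 < q)
    (hp : IsCoprime p (q : ℤ)) {Γ : ℝ} (hΓ : ∀ N, |kerSum p q N| ≤ Γ * q)
    (hη : |α - p / q| ≤ 1 / (100 * (q : ℝ) ^ 2))
    {g : ℝ → ℝ} (hgper : Function.Periodic g 1) {ℓ : ℝ} (hℓ : ∀ x y, |g x - g y| ≤ ℓ * |x - y|)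
    {i : ℕ} (hi : i < q) (z : ℤ) {x : ℝ} (hx : |x + i * α - z| ≤ 51 / 100 * (q : ℝ)⁻¹)
    (hx0 : x + i * α - z ≠ 0) :
    |birkhoffRot α (symLogRoof g) q x - birkhoffRot α (symLogRoof g) q (1 / (2 * (q : ℝ)))
      + Real.log (q * |x + i * α - z|)| ≤ 2 * (4 + Γ + ℓ) + 5 := by
  have hqR : (0 : ℝ) < q := by exact_mod_cast hq
  have hq1 : (q : ℝ)⁻¹ ≤ 1 := inv_le_one_of_one_le₀ (by exact_mod_cast hq)
  have hc : (1 / (2 * (q : ℝ))) = 1 / 2 * (q : ℝ)⁻¹ := by field_simp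
  have hcpos : 0 < 1 / (2 * (q : ℝ)) := by positivity
  have hcle : |1 / (2 * (q : ℝ))| ≤ 51 / 100 * (q : ℝ)⁻¹ := by
    rw [abs_of_pos hcpos, hc]; linarith [inv_pos.2 hqR]
  have m1 := abs_birkhoffRot_sub_le hq hp hΓ hη hgper hℓ hi z hx
  have m2 := abs_birkhoffRot_sub_le hq hp hΓ hη hgper hℓ hq (i₀ := 0) 0
    (x := 1 / (2 * (q : ℝ))) (by simpa using hcle)
  have s1 := abs_symLog_add_log_le hx0 (hx.trans (by linarith))
  have s2 := abs_symLog_add_log_le hcpos.ne' (hcle.trans (by linarith))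
  have e1 : symLog (x + i * α - z) = symLog (x + i * α) := by
    have := periodic_add_int symLog_periodic (x + i * α) (-z)
    rwa [Int.cast_neg, ← sub_eq_add_neg] at this
  have e2 : Real.log |1 / (2 * (q : ℝ))| = -Real.log 2 - Real.log q := by
    rw [abs_of_pos hcpos, one_div, Real.log_inv, Real.log_mul two_ne_zero hqR.ne']; ring
  have hl2 : Real.log 2 ≤ 1 := by linarith [Real.log_le_sub_one_of_pos two_pos]
  have hl2' : 0 ≤ Real.log 2 := Real.log_nonneg one_le_two
  rw [e1] at s1
  rw [e2] at s2
  rw [Real.log_mul hqR.ne' (abs_pos.2 hx0).ne']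
  rw [Nat.cast_zero, zero_mul, add_zero] at m2
  rw [abs_le] at *
  constructor <;> linarith [m1.1, m1.2, m2.1, m2.2, s1.1, s1.2, s2.1, s2.2]

lemma volume_AkSet_le {α : ℝ} {p : ℤ} {q : ℕ} (hq : 0 < q) (hp : IsCoprime p (q : ℤ))
    (hη : |α - p / q| ≤ 1 / (100 * (q : ℝ) ^ 2)) {g : ℝ → ℝ} {C b : ℝ}
    (hC : ∀ i < q, ∀ (z : ℤ) (x : ℝ), |x + i * α - z| ≤ 51 / 100 * (q : ℝ)⁻¹ →
      x + i * α - z ≠ 0 →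
      |birkhoffRot α (symLogRoof g) q x - birkhoffRot α (symLogRoof g) q (1 / (2 * (q : ℝ)))
        + Real.log (q * |x + i * α - z|)| ≤ C) (hb : C < b) :
    volume (AkSet α g q b) ≤ ENNReal.ofReal (10 * Real.exp C * Real.exp (-b)) := by
  have hqR : (0 : ℝ) < q := by exact_mod_cast hq
  have hq1 : (q : ℝ)⁻¹ ≤ 1 := inv_le_one_of_one_le₀ (by exact_mod_cast hq)
  set δ : ℝ := Real.exp (C - b) * (q : ℝ)⁻¹ with hδ
  have hδ0 : 0 < δ := by positivity
  have hsub : AkSet α g q b ⊆ ⋃ i ∈ Finset.range q,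
      ⋃ z ∈ Finset.Icc (⌊i * α⌋ - 1) (⌊i * α⌋ + 3), Metric.closedBall ((z : ℝ) - i * α) δ := by
    rintro x ⟨⟨hx0, hx1⟩, hxb⟩
    obtain ⟨i, hi, z, hz⟩ := exists_orbit_near hq hp hη x
    simp only [Set.mem_iUnion]
    refine ⟨i, Finset.mem_range.2 hi, z, ?_, ?_⟩
    · have hz' : |x + i * α - z| ≤ 51 / 100 := hz.trans (by linarith)
      obtain ⟨h1, h2⟩ := abs_le.1 hz'
      have h3 := Int.floor_le (i * α)
      have h4 := Int.lt_floor_add_one (i * α)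
      rw [Finset.mem_Icc]
      constructor
      · have : ((⌊i * α⌋ - 1 : ℤ) : ℝ) ≤ z := by push_cast; linarith
        exact_mod_cast this
      · have : (z : ℝ) ≤ ((⌊i * α⌋ + 3 : ℤ) : ℝ) := by push_cast; linarith
        exact_mod_cast this
    · rw [Metric.mem_closedBall, Real.dist_eq, show x - (z - i * α) = x + i * α - z by ring]
      by_cases h0 : x + i * α - z = 0
      · rw [h0, abs_zero]; exact hδ0.le
      have hpos := abs_pos.2 h0
      have h := hC i hi z x hz h0
      have hlt : Real.log (q * |x + i * α - z|) ≤ 0 := by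
        apply Real.log_nonpos (by positivity)
        calc (q : ℝ) * |x + i * α - z| ≤ q * (51 / 100 * (q : ℝ)⁻¹) := by gcongr
          _ = 51 / 100 := by field_simp
          _ ≤ 1 := by norm_num
      obtain ⟨h1, h2⟩ := abs_le.1 h
      have hlog : Real.log (q * |x + i * α - z|) ≤ C - b := by
        rcases le_abs.1 hxb with h3 | h3 <;> linarith
      rw [Real.log_le_iff_le_exp (by positivity)] at hlog
      rw [hδ, ← div_eq_mul_inv, le_div_iff₀ hqR]
      linarith
  refine (measure_mono hsub).trans ?_
  refine (measure_biUnion_finset_le _ _).trans ?_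
  have hin : ∀ i ∈ Finset.range q,
      volume (⋃ z ∈ Finset.Icc (⌊i * α⌋ - 1) (⌊i * α⌋ + 3), Metric.closedBall ((z : ℝ) - i * α) δ)
        ≤ ENNReal.ofReal (10 * δ) := by
    intro i _
    refine (measure_biUnion_finset_le _ _).trans (le_of_eq ?_)
    simp only [Real.volume_closedBall]
    rw [Finset.sum_const, Int.card_Icc, show (⌊i * α⌋ + 3 + 1 - (⌊i * α⌋ - 1)).toNat = 5 by omega,
      ← ENNReal.ofReal_nsmul]
    congr 1
    rw [nsmul_eq_mul]; push_cast; ring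
  refine (Finset.sum_le_sum hin).trans (le_of_eq ?_)
  rw [Finset.sum_const, Finset.card_range, ← ENNReal.ofReal_nsmul]
  congr 1
  rw [nsmul_eq_mul, hδ, sub_eq_add_neg, Real.exp_add]
  field_simp

lemma exists_Ioo_subset_AkSet {α : ℝ} {p : ℤ} {q : ℕ} (hq : 0 < q) (hp : IsCoprime p (q : ℤ))
    (hη : |α - p / q| ≤ 1 / (100 * (q : ℝ) ^ 2)) {g : ℝ → ℝ} {C b : ℝ}
    (hC : ∀ i < q, ∀ (z : ℤ) (x : ℝ), |x + i * α - z| ≤ 51 / 100 * (q : ℝ)⁻¹ →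
      x + i * α - z ≠ 0 →
      |birkhoffRot α (symLogRoof g) q x - birkhoffRot α (symLogRoof g) q (1 / (2 * (q : ℝ)))
        + Real.log (q * |x + i * α - z|)| ≤ C)
    {δ : ℝ} (hδ : δ = Real.exp (-b - C) * (q : ℝ)⁻¹) (hδq : δ ≤ 1 / 2 * (q : ℝ)⁻¹)
    {j : ℕ} (hj : j < q) :
    ∃ a : ℝ, j * (q : ℝ)⁻¹ ≤ a ∧ a + δ ≤ (j + 1) * (q : ℝ)⁻¹ ∧
      Set.Ioo a (a + δ) ⊆ AkSet α g q b := by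
  have hqR : (0 : ℝ) < q := by exact_mod_cast hq
  have hqi : (0 : ℝ) < (q : ℝ)⁻¹ := by positivity
  have hδ0 : 0 < δ := by rw [hδ]; positivity
  have hnear : ∀ i < q, ∀ (z : ℤ) (x : ℝ), x ∈ Set.Ico (0 : ℝ) 1 → x + i * α - z ≠ 0 →
      |x + i * α - z| ≤ δ → x ∈ AkSet α g q b := by
    intro i hi z x hx h0 hle
    refine ⟨hx, ?_⟩
    have h := (abs_le.1 (hC i hi z x (hle.trans (by linarith)) h0)).1
    have hpos := abs_pos.2 h0
    have hlog : Real.log (q * |x + i * α - z|) ≤ -b - C := by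
      rw [Real.log_le_iff_le_exp (by positivity)]
      rw [hδ, ← div_eq_mul_inv, le_div_iff₀ hqR] at hle
      linarith
    exact le_abs.2 (Or.inl (by linarith))
  have hcell : ∀ x, j * (q : ℝ)⁻¹ ≤ x → x < (j + 1) * (q : ℝ)⁻¹ → x ∈ Set.Ico (0 : ℝ) 1 := by
    intro x h1 h2
    refine ⟨le_trans (by positivity) h1, h2.trans_le ?_⟩
    rw [← div_eq_mul_inv, div_le_one hqR]
    exact_mod_cast hj
  have hsol : ∀ u : ℤ, ∃ i < q, ∃ z : ℤ, (z : ℝ) - i * α = u * (q : ℝ)⁻¹ - i * (α - p / q) := by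
    intro u
    obtain ⟨i, hi, z, hz⟩ := exists_orbit_dvd hq hp u
    refine ⟨i, hi, z, ?_⟩
    have hz' : (u : ℝ) + i * p = q * z := by exact_mod_cast hz
    field_simp
    linear_combination -hz'
  rcases le_total (α - p / q) 0 with hneg | hpos
  · obtain ⟨i, hi, z, hz⟩ := hsol j
    have h1 := (abs_le.1 (abs_natCast_mul_sub_le hq hη hi)).1
    have h2 : (i : ℝ) * (α - p / q) ≤ 0 := mul_nonpos_of_nonneg_of_nonpos (by positivity) hneg
    push_cast at hz
    refine ⟨z - i * α, by linarith, by linarith, fun x hx => ?_⟩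
    obtain ⟨hx1, hx2⟩ := hx
    refine hnear i hi z x (hcell x (by linarith) (by linarith)) (by linarith) ?_
    rw [abs_of_pos (by linarith)]; linarith
  · obtain ⟨i, hi, z, hz⟩ := hsol (j + 1)
    have h1 := (abs_le.1 (abs_natCast_mul_sub_le hq hη hi)).2
    have h2 : 0 ≤ (i : ℝ) * (α - p / q) := by positivity
    push_cast at hz
    refine ⟨z - i * α - δ, by linarith, by linarith, fun x hx => ?_⟩
    obtain ⟨hx1, hx2⟩ := hx
    refine hnear i hi z x (hcell x (by linarith) (by linarith)) (by linarith) ?_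
    rw [abs_of_neg (by linarith)]; linarith

lemma le_volume_AkSet {α : ℝ} {p : ℤ} {q : ℕ} (hq : 0 < q) (hp : IsCoprime p (q : ℤ))
    (hη : |α - p / q| ≤ 1 / (100 * (q : ℝ) ^ 2)) {g : ℝ → ℝ} {C b : ℝ}
    (hC : ∀ i < q, ∀ (z : ℤ) (x : ℝ), |x + i * α - z| ≤ 51 / 100 * (q : ℝ)⁻¹ →
      x + i * α - z ≠ 0 →
      |birkhoffRot α (symLogRoof g) q x - birkhoffRot α (symLogRoof g) q (1 / (2 * (q : ℝ)))
        + Real.log (q * |x + i * α - z|)| ≤ C) (hbC : 1 ≤ b + C) :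
    ENNReal.ofReal (Real.exp (-b - C)) ≤ volume (AkSet α g q b) := by
  have hqR : (0 : ℝ) < q := by exact_mod_cast hq
  obtain ⟨δ, hδ⟩ : ∃ δ, δ = Real.exp (-b - C) * (q : ℝ)⁻¹ := ⟨_, rfl⟩
  have hexp : Real.exp (-b - C) ≤ 1 / 2 := by
    rw [show -b - C = -(b + C) by ring, Real.exp_neg, one_div]
    have := Real.add_one_le_exp (b + C)
    gcongr
    linarith
  have hδq : δ ≤ 1 / 2 * (q : ℝ)⁻¹ := by rw [hδ]; gcongr
  choose! a ha1 ha2 ha3 using fun (j : ℕ) (hj : j ∈ Finset.range q) =>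
    exists_Ioo_subset_AkSet hq hp hη hC hδ hδq (Finset.mem_range.1 hj)
  have hlt : ∀ j ∈ Finset.range q, ∀ j' ∈ Finset.range q, j < j' →
      Disjoint (Set.Ioo (a j) (a j + δ)) (Set.Ioo (a j') (a j' + δ)) := by
    intro j hj j' hj' h
    rw [Set.disjoint_left]
    rintro x ⟨_, hx⟩ ⟨hx', _⟩
    have h1 : ((j : ℝ) + 1) * (q : ℝ)⁻¹ ≤ j' * (q : ℝ)⁻¹ := by
      gcongr
      exact_mod_cast h
    linarith [ha2 j hj, ha1 j' hj']
  have hdisj : ((Finset.range q : Finset ℕ) : Set ℕ).PairwiseDisjoint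
      fun j => Set.Ioo (a j) (a j + δ) := by
    intro j hj j' hj' hne
    rcases hne.lt_or_gt with h | h
    · exact hlt j hj j' hj' h
    · exact (hlt j' hj' j hj h).symm
  have hU : volume (⋃ j ∈ Finset.range q, Set.Ioo (a j) (a j + δ))
      = ENNReal.ofReal (Real.exp (-b - C)) := by
    rw [measure_biUnion_finset hdisj fun _ _ => measurableSet_Ioo]
    simp only [Real.volume_Ioo, add_sub_cancel_left]
    rw [Finset.sum_const, Finset.card_range, ← ENNReal.ofReal_nsmul, nsmul_eq_mul, hδ]
    congr 1
    field_simp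
  rw [← hU]
  exact measure_mono (Set.iUnion₂_subset ha3)

/-- For `α ∈ 𝒞_{K,L}` (`L > K`) with associated sequence `(n_k)` and
`f(x) = -log x - log(1-x) + g(x)` (`g ∈ C³(𝕋)`, `g > 0`), there are `D > 0`, `b₀ > 0` and
`k₀` such that for all `k ≥ k₀`, `b ≥ b₀`:
`D⁻¹ e^{-b} ≤ Leb(A_k(b)) ≤ D e^{-b}`. -/
theorem statement10 (K L : ℕ) (hKL : K < L)
    (α : ℝ) (hirr : Irrational α) (hα : α ∈ Set.Ioo (0 : ℝ) 1)
    (nk : ℕ → ℕ) (hnk : StrictMono nk) (c : ℝ) (hc : 0 < c)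
    (hdio1 : ∀ k n : ℕ, 1 ≤ n → n ≤ nk k →
      (cfA α (nk k + 1 - n) : ℝ) ≤ Real.exp (c * n))
    (hdio2 : ∀ k : ℕ, 100 * (K ^ 2 + L ^ 2) < cfA α (nk k + 1) ∧
      cfA α (nk k + 1) < 200 * (K ^ 2 + L ^ 2))
    (g : ℝ → ℝ) (hgper : Function.Periodic g 1) (hg : ContDiff ℝ 3 g) (hgpos : ∀ x, 0 < g x) :
    ∃ D > (0 : ℝ), ∃ b₀ > (0 : ℝ), ∃ k₀ : ℕ, ∀ k ≥ k₀, ∀ b ≥ b₀,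
      ENNReal.ofReal (D⁻¹ * Real.exp (-b)) ≤ volume (AkSet α g (cfQ α (nk k)) b) ∧
      volume (AkSet α g (cfQ α (nk k)) b) ≤ ENNReal.ofReal (D * Real.exp (-b)) := by
  obtain ⟨ℓ, hℓ⟩ := exists_lipschitz_bound hgper (hg.of_le (by norm_num))
  have hℓ0 : 0 ≤ ℓ := by simpa using (abs_nonneg _).trans (hℓ 1 0)
  obtain ⟨C, hCdef⟩ : ∃ C, C = 2 * (4 + 26 * (3 + 9 * c) + ℓ) + 5 := ⟨_, rfl⟩
  have hC0 : 0 ≤ C := by rw [hCdef]; positivity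
  refine ⟨10 * Real.exp C, by positivity, C + 1, by positivity, 0, fun k _ b hb => ?_⟩
  have hq := cfQ_pos hirr (nk k)
  have hqR : (0 : ℝ) < cfQ α (nk k) := by exact_mod_cast hq
  have hp := cf_isCoprime α (nk k)
  have hΓ := abs_kerSum_cf_le hirr hc (hdio1 k)
  have hη : |α - cfP α (nk k) / cfQ α (nk k)| ≤ 1 / (100 * (cfQ α (nk k) : ℝ) ^ 2) := by
    refine (abs_sub_cf_le hirr hα (nk k)).trans ?_
    have h1 : 100 ≤ cfA α (nk k + 1) := by
      have : 1 ≤ L ^ 2 := Nat.one_le_pow _ _ (by omega)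
      have := (hdio2 k).1
      omega
    have h2 : 100 * cfQ α (nk k) ≤ cfQ α (nk k + 1) :=
      (Nat.mul_le_mul_right _ h1).trans (cfQ_succ_bounds hirr (nk k)).1
    have h3 : (100 * cfQ α (nk k) : ℝ) ≤ cfQ α (nk k + 1) := by exact_mod_cast h2
    apply one_div_le_one_div_of_le (by positivity)
    nlinarith
  have hC : ∀ i < cfQ α (nk k), ∀ (z : ℤ) (x : ℝ),
      |x + i * α - z| ≤ 51 / 100 * (cfQ α (nk k) : ℝ)⁻¹ → x + i * α - z ≠ 0 →
      |birkhoffRot α (symLogRoof g) (cfQ α (nk k)) x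
        - birkhoffRot α (symLogRoof g) (cfQ α (nk k)) (1 / (2 * (cfQ α (nk k) : ℝ)))
        + Real.log (cfQ α (nk k) * |x + i * α - z|)| ≤ C := by
    intro i hi z x hx hx0
    rw [hCdef]
    exact abs_birkhoffRot_sub_center_le hq hp hΓ hη hgper hℓ hi z hx hx0
  refine ⟨le_trans (ENNReal.ofReal_le_ofReal ?_) (le_volume_AkSet hq hp hη hC (by linarith)),
    volume_AkSet_le hq hp hη hC (by linarith)⟩
  rw [sub_eq_add_neg, Real.exp_add, mul_inv, ← Real.exp_neg]
  have : 0 ≤ Real.exp (-C) * Real.exp (-b) := by positivity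
  linarith
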